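/- Let f be a continuous self-map of a compact interval. Then the set Per(f) of periodic points is closed if and only if Per(f) = Ω(f), where Ω(f) is the non-wandering set. -/

import Mathlib

open Set Topology Filter

namespace Paper

variable {X : Type*} [TopologicalSpace X]

/-- The orbit of a point under a flow. -/
def orbit (v : Flow ℝ X) (x : X) : Set X := {y | ∃ t : ℝ, y = v t x}

/-- The ω-limit set: ⋂ₙ closure {v_t(x) | t > n}. -/
def omegaLimit (v : Flow ℝ X) (x : X) : Set X :=
  ⋂ n : ℝ, closure {y | ∃ t : ℝ, n < t ∧ y = v t x}

/-- The α-limit set: ⋂ₙ closure {v_t(x) | t < n}. -/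
def alphaLimit (v : Flow ℝ X) (x : X) : Set X :=
  ⋂ n : ℝ, closure {y | ∃ t : ℝ, t < n ∧ y = v t x}

/-- A point is recurrent if it belongs to its ω- or α-limit set. -/
def Recurrent (v : Flow ℝ X) (x : X) : Prop :=
  x ∈ omegaLimit v x ∪ alphaLimit v x

/-- A point is singular if it is fixed by every time map. -/
def Singular (v : Flow ℝ X) (x : X) : Prop := ∀ t : ℝ, v t x = x

/-- A point is periodic if it has a minimal positive period. -/
def Periodic (v : Flow ℝ X) (x : X) : Prop :=
  ∃ T : ℝ, 0 < T ∧ v T x = x ∧ ∀ t ∈ Set.Ioo 0 T, v t x ≠ x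

/-- A closed point: singular or periodic. -/
def IsClosedPt (v : Flow ℝ X) (x : X) : Prop := Singular v x ∨ Periodic v x

/-- A point is non-wandering if for every neighborhood `U` and every `N > 0`
there is `t` with `|t| > N` and `v_t(U) ∩ U ≠ ∅`. -/
def NonWandering (v : Flow ℝ X) (x : X) : Prop :=
  ∀ U ∈ nhds x, ∀ N : ℝ, 0 < N → ∃ t : ℝ, N < |t| ∧ ((v t) '' U ∩ U).Nonempty

/-- The non-wandering set Ω(v). -/
def nonWanderingSet (v : Flow ℝ X) : Set X := {x | NonWandering v x}

/-- Sing(v): the set of singular points. -/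
def singSet (v : Flow ℝ X) : Set X := {x | Singular v x}

/-- Per(v): the union of periodic orbits. -/
def perSet (v : Flow ℝ X) : Set X := {x | Periodic v x}

/-- Cl(v): the set of closed points. -/
def clSet (v : Flow ℝ X) : Set X := {x | IsClosedPt v x}

/-- R(v): the set of non-closed recurrent points. -/
def recSet (v : Flow ℝ X) : Set X := {x | Recurrent v x ∧ ¬ IsClosedPt v x}

/-- P(v): the set of non-closed non-recurrent points. -/
def pSet (v : Flow ℝ X) : Set X := {x | ¬ Recurrent v x ∧ ¬ IsClosedPt v x}

/-- An invariant subset. -/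
def Invariant (v : Flow ℝ X) (A : Set X) : Prop := ∀ t : ℝ, (v t) '' A = A

/-- A proper orbit: an orbit having an open neighborhood in which it is closed. -/
def ProperOrbit (v : Flow ℝ X) (x : X) : Prop :=
  ∃ U : Set X, IsOpen U ∧ orbit v x ⊆ U ∧ orbit v x = closure (orbit v x) ∩ U

/-- A locally dense point: the closure of its orbit has nonempty interior. -/
def LocallyDense (v : Flow ℝ X) (x : X) : Prop :=
  (interior (closure (orbit v x))).Nonempty

/-- LD(v): the union of locally dense orbits. -/
def ldSet (v : Flow ℝ X) : Set X := {x | LocallyDense v x}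

/-- E(v): the union of exceptional orbits (neither proper nor locally dense). -/
def eSet (v : Flow ℝ X) : Set X := {x | ¬ ProperOrbit v x ∧ ¬ LocallyDense v x}

/-- A minimal set: a nonempty closed invariant set with no proper nonempty
closed invariant subset. -/
def IsMinimalSet (v : Flow ℝ X) (A : Set X) : Prop :=
  A.Nonempty ∧ IsClosed A ∧ Invariant v A ∧
    ∀ B ⊆ A, B.Nonempty → IsClosed B → Invariant v B → B = A

end Paper


namespace IntervalMap

open Function

theorem subset_image_iterate {α : Type*} {h : α → α} {s t : Set α} (hst : s ⊆ t) (ht : t ⊆ h '' s) :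
    ∀ k : ℕ, 1 ≤ k → t ⊆ h^[k] '' s := by
  intro k hk
  induction k, hk using Nat.le_induction with
  | base => simpa using ht
  | succ k _ ih =>
    rw [iterate_succ', image_comp]
    exact ht.trans (image_mono (hst.trans ih))

theorem mem_periodicPts_of_iterate {α : Type*} {f : α → α} {x : α} {k : ℕ} {w : α} (hw : w ∈ periodicPts f)
    (h : f^[k] w = x) : x ∈ periodicPts f := by
  obtain ⟨p, hp, hpw⟩ := hw
  exact ⟨p, hp, h ▸ hpw.apply_iterate k⟩

/-- A compact interval covered by the image of another one is the exact image of a compact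
subinterval of the latter. -/
theorem exists_Icc_image_eq {β γ : Type*}
    [ConditionallyCompleteLinearOrder β] [TopologicalSpace β] [OrderTopology β] [DenselyOrdered β]
    [LinearOrder γ] [TopologicalSpace γ] [OrderTopology γ]
    {h : β → γ} (hh : Continuous h) {a b : γ} {c d : β} (hab : a ≤ b)
    (hcov : Icc a b ⊆ h '' Icc c d) :
    ∃ c' d', c' ≤ d' ∧ Icc c' d' ⊆ Icc c d ∧ h '' Icc c' d' = Icc a b := by
  have key : ∀ {δ : Type _} [ConditionallyCompleteLinearOrder δ] [TopologicalSpace δ]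
      [OrderTopology δ] [DenselyOrdered δ] (h : δ → γ) (_ : Continuous h) (u v : δ),
      u ≤ v → h u = a → h v = b →
      ∃ c' d', c' ≤ d' ∧ Icc c' d' ⊆ Icc u v ∧ h '' Icc c' d' = Icc a b := by
    intro δ _ _ _ _ h hh u v huv hu hv
    obtain ⟨d', ⟨⟨hud, hdv⟩, hd⟩, hdmin⟩ :=
      (isCompact_Icc.inter_right (isClosed_singleton.preimage hh) :
        IsCompact (Icc u v ∩ h ⁻¹' {b})).exists_isLeast ⟨v, ⟨huv, le_rfl⟩, hv⟩
    obtain ⟨c', ⟨⟨huc, hcd⟩, hc⟩, hcmax⟩ :=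
      (isCompact_Icc.inter_right (isClosed_singleton.preimage hh) :
        IsCompact (Icc u d' ∩ h ⁻¹' {a})).exists_isGreatest ⟨u, ⟨le_rfl, hud⟩, hu⟩
    simp only [mem_preimage, mem_singleton_iff] at hd hc
    refine ⟨c', d', hcd, Icc_subset_Icc huc hdv, Subset.antisymm ?_ ?_⟩
    · rintro _ ⟨z, ⟨hz1, hz2⟩, rfl⟩
      constructor
      · by_contra! hlt
        obtain ⟨z', hz', e⟩ := intermediate_value_Icc hz2 hh.continuousOn
          (show a ∈ Icc (h z) (h d') from ⟨hlt.le, hd ▸ hab⟩)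
        have : z' ≤ c' := hcmax ⟨⟨huc.trans (hz1.trans hz'.1), hz'.2⟩, e⟩
        have h1 : z = c' := le_antisymm (hz'.1.trans this) hz1
        rw [h1, hc] at hlt
        exact lt_irrefl _ hlt
      · by_contra! hlt
        obtain ⟨z', hz', e⟩ := intermediate_value_Icc hz1 hh.continuousOn
          (show b ∈ Icc (h c') (h z) from ⟨hc ▸ hab, hlt.le⟩)
        have : d' ≤ z' := hdmin ⟨⟨huc.trans hz'.1, hz'.2.trans (hz2.trans hdv)⟩, e⟩
        have h1 : z = d' := le_antisymm hz2 (this.trans hz'.2)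
        rw [h1, hd] at hlt
        exact lt_irrefl _ hlt
    · have := intermediate_value_Icc hcd (hh.continuousOn (s := Icc c' d'))
      rwa [hc, hd] at this
  obtain ⟨u, hu, hua⟩ := hcov ⟨le_rfl, hab⟩
  obtain ⟨v, hv, hvb⟩ := hcov ⟨hab, le_rfl⟩
  rcases le_total u v with huv | huv
  · obtain ⟨c', d', h1, h2, h3⟩ := key h hh u v huv hua hvb
    exact ⟨c', d', h1, h2.trans (Icc_subset_Icc hu.1 hv.2), h3⟩
  · obtain ⟨d', c', h1, h2, h3⟩ := key (δ := βᵒᵈ) (fun z => h (OrderDual.ofDual z))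
      (hh.comp continuous_ofDual) (OrderDual.toDual u) (OrderDual.toDual v) huv hua hvb
    have hset : Icc d' c' = OrderDual.ofDual ⁻¹' Icc (OrderDual.ofDual c') (OrderDual.ofDual d') := by
      ext z
      exact and_comm
    refine ⟨OrderDual.ofDual c', OrderDual.ofDual d', h1, fun z hz => ?_, ?_⟩
    · have := h2 (show OrderDual.toDual z ∈ Icc d' c' from ⟨hz.2, hz.1⟩)
      exact ⟨hv.1.trans this.2, le_trans (show z ≤ u from this.1) hu.2⟩
    · rw [← h3, hset]
      rfl

/-- A preconnected set of a linear order misses only finitely many points of its closure. -/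
theorem finite_closure_diff {α : Type*} [LinearOrder α] [TopologicalSpace α]
    [OrderTopology α] {s : Set α} (hs : IsPreconnected s) : (closure s \ s).Finite := by
  by_contra hinf
  obtain ⟨t, hts, htc⟩ := Set.Infinite.exists_subset_card_eq hinf 3
  let e := t.orderEmbOfFin htc
  have he : ∀ i, e i ∈ closure s \ s := fun i => hts (t.orderEmbOfFin_mem htc i)
  obtain ⟨a, ha, has⟩ := mem_closure_iff.1 (he 0).1 (Iio (e 1)) isOpen_Iio
    (e.strictMono (by decide))
  obtain ⟨b, hb, hbs⟩ := mem_closure_iff.1 (he 2).1 (Ioi (e 1)) isOpen_Ioi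
    (e.strictMono (by decide))
  exact (he 1).2 (hs.Icc_subset has hbs ⟨le_of_lt ha, le_of_lt hb⟩)

variable {α : Type*} [ConditionallyCompleteLinearOrder α] [TopologicalSpace α] [OrderTopology α]
  [DenselyOrdered α] {f : α → α}

theorem exists_fixedPt_of_subset_image {h : α → α} (hh : Continuous h) {c d : α} (hcd : c ≤ d)
    (hcov : Icc c d ⊆ h '' Icc c d) : ∃ z ∈ Icc c d, h z = z := by
  obtain ⟨u, hu, huc⟩ := hcov ⟨le_rfl, hcd⟩
  obtain ⟨v, hv, hvd⟩ := hcov ⟨hcd, le_rfl⟩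
  obtain ⟨z, hz, e⟩ := exists_mem_uIcc_isFixedPt (a := v) (b := u) hh.continuousOn
    (hvd ▸ hv.2) (huc ▸ hu.1)
  exact ⟨z, uIcc_subset_Icc hv hu hz, e⟩

theorem image_Icc_superset {h : α → α} (hh : Continuous h) {a b u v : α}
    (hu : u ∈ Icc a b) (hv : v ∈ Icc a b) : Icc (h u) (h v) ⊆ h '' Icc a b :=
  (isPreconnected_Icc.image h hh.continuousOn).Icc_subset (mem_image_of_mem h hu)
    (mem_image_of_mem h hv)

theorem mem_periodicPts_of_horseshoe (hf : Continuous f) (hcl : IsClosed (periodicPts f))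
    {c w y : α} (hcw : c ≤ w) (hwy : w ≤ y) {m n : ℕ} (hm : 1 ≤ m) (hn : 1 ≤ n)
    (hK : Icc c y ⊆ f^[m] '' Icc c w) (hL : Icc c y ⊆ f^[n] '' Icc w y) :
    w ∈ periodicPts f := by
  set F := f^[m * n] with hF
  have hFc : Continuous F := hf.iterate _
  have hK' : Icc c y ⊆ F '' Icc c w := by
    rw [hF, iterate_mul]
    exact subset_image_iterate (Icc_subset_Icc_right hwy) hK n hn
  have hL' : Icc c y ⊆ F '' Icc w y := by
    rw [hF, mul_comm, iterate_mul]
    exact subset_image_iterate (Icc_subset_Icc_left hcw) hL m hm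
  have chain : ∀ k : ℕ, ∃ a b, a ≤ b ∧ (∀ i ≤ k, ∀ z ∈ Icc a b, F^[i] z ∈ Icc c w) ∧
      F^[k] '' Icc a b = Icc c w := by
    intro k
    induction k with
    | zero => exact ⟨c, w, hcw, fun i hi z hz => by simpa [Nat.le_zero.1 hi] using hz, by simp⟩
    | succ k ih =>
      obtain ⟨a, b, hab, hi, him⟩ := ih
      have hsub : Icc a b ⊆ Icc c w := fun z hz => hi 0 (Nat.zero_le _) z hz
      obtain ⟨a', b', hab', hsub', him'⟩ := exists_Icc_image_eq hFc hab
        (hsub.trans ((Icc_subset_Icc_right hwy).trans hK'))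
      refine ⟨a', b', hab', fun i hik z hz => ?_, ?_⟩
      · cases i with
        | zero => exact hsub' hz
        | succ i =>
          rw [iterate_succ_apply]
          exact hi i (by omega) _ (him' ▸ mem_image_of_mem F hz)
      · rw [iterate_succ, image_comp, him', him]
  let Q : ℕ → Set α := fun k =>
    (Icc w y ∩ periodicPts f) ∩ ⋂ i : ℕ, ⋂ _ : i ≤ k, F^[i + 1] ⁻¹' Icc c w
  have hQcl : ∀ k, IsClosed (Q k) := fun k => (isClosed_Icc.inter hcl).inter
    (isClosed_iInter fun i => isClosed_iInter fun _ => isClosed_Icc.preimage (hFc.iterate _))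
  have hQ : (⋂ k, Q k).Nonempty := by
    refine IsCompact.nonempty_iInter_of_sequence_nonempty_isCompact_isClosed Q ?_ ?_ ?_ hQcl
    · rintro k z ⟨hz, hz'⟩
      simp only [mem_iInter] at hz'
      refine ⟨hz, ?_⟩
      simp only [mem_iInter]
      exact fun i hi => hz' i (by omega)
    · intro k
      obtain ⟨a, b, hab, hi, him⟩ := chain k
      have hsub : Icc a b ⊆ Icc c w := fun z hz => hi 0 (Nat.zero_le _) z hz
      obtain ⟨a', b', hab', hsub', him'⟩ := exists_Icc_image_eq hFc hab
        (hsub.trans ((Icc_subset_Icc_right hwy).trans hL'))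
      have him2 : F^[k + 2] '' Icc a' b' = F '' Icc c w := by
        rw [iterate_succ, image_comp, him', iterate_succ', image_comp, him]
      obtain ⟨z, hz, hfix⟩ := exists_fixedPt_of_subset_image (hFc.iterate (k + 2)) hab'
        (hsub'.trans ((Icc_subset_Icc_left hcw).trans (hK'.trans him2.ge)))
      refine ⟨z, ⟨hsub' hz, mk_mem_periodicPts (n := m * n * (k + 2)) (by positivity) ?_⟩, ?_⟩
      · rwa [hF, ← iterate_mul] at hfix
      · simp only [mem_iInter]
        intro i hik
        rw [mem_preimage, iterate_succ_apply]
        exact hi i hik _ (him' ▸ mem_image_of_mem F hz)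
    · exact isCompact_Icc.of_isClosed_subset (hQcl 0) fun z hz => hz.1.1
  obtain ⟨q, hq⟩ := hQ
  simp only [mem_iInter] at hq
  have hqL := (hq 0).1.1
  have hqP := (hq 0).1.2
  have hqK : ∀ i, F^[i + 1] q ∈ Icc c w := fun i => by
    have := (hq i).2
    simp only [mem_iInter] at this
    exact this i le_rfl
  obtain ⟨k, hk, hkq⟩ := hqP
  have hfix : F^[k - 1 + 1] q = q := by
    rw [Nat.sub_add_cancel hk, hF, ← iterate_mul]
    exact hkq.const_mul (m * n)
  have hqw : q = w := le_antisymm (hfix ▸ (hqK (k - 1)).2) hqL.1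
  exact hqw ▸ ⟨k, hk, hkq⟩

/-- Points of a neighbourhood of a non-periodic point return to it only after a long time. -/
theorem eventually_iterate_notMem {α : Type*} [TopologicalSpace α] [T2Space α] {f : α → α}
    (hf : Continuous f) {x : α} (hx : x ∉ periodicPts f) (N : ℕ) :
    ∃ V ∈ 𝓝 x, ∀ m, 1 ≤ m → m ≤ N → ∀ t ∈ V, f^[m] t ∉ V := by
  induction N with
  | zero => exact ⟨univ, univ_mem, fun m h1 h2 => by omega⟩
  | succ N ih =>
    obtain ⟨V, hV, h⟩ := ih
    have hne : x ≠ f^[N + 1] x := fun e => hx ⟨N + 1, Nat.succ_pos _, e.symm⟩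
    obtain ⟨A, B, hA, hB, hAB⟩ := t2_separation_nhds hne
    refine ⟨V ∩ (A ∩ f^[N + 1] ⁻¹' B),
      inter_mem hV (inter_mem hA ((hf.iterate _).continuousAt hB)), ?_⟩
    rintro m h1 h2 t ⟨htV, -, htB⟩ ⟨hmV, hmA, -⟩
    rcases Nat.of_le_succ h2 with h2 | rfl
    · exact h m h1 h2 t htV hmV
    · exact disjoint_left.1 hAB hmA htB

/-- A non-wandering point is the image of arbitrarily close points. -/
theorem exists_iterate_eq_of_nonwandering [CompactSpace α] (hf : Continuous f) {x : α}
    (hx : x ∉ periodicPts f)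
    (hnw : ∀ U ∈ 𝓝 x, ∃ n : ℕ, 1 ≤ n ∧ (f^[n] '' U ∩ U).Nonempty) {U : Set α} (hU : U ∈ 𝓝 x) :
    ∃ l : ℕ, 1 ≤ l ∧ ∃ t ∈ U, f^[l] t = x := by
  obtain ⟨a, b, hxab, habn, habU⟩ := exists_Icc_mem_subset_of_mem_nhds hU
  by_contra! hcon
  have hcon' : ∀ l, 1 ≤ l → ∀ t ∈ Icc a b, f^[l] t ≠ x := fun l hl t ht => hcon l hl t (habU ht)
  obtain ⟨n, hn, _, ⟨t₀, ht₀, rfl⟩, ht₀'⟩ := hnw _ habn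
  let G : ℕ → Set α := fun r => ⋃ k : ℕ, f^[k * n + (r + 1)] '' Icc a b
  have hGconn : ∀ r, IsPreconnected (G r) := by
    intro r
    refine IsPreconnected.iUnion_of_chain
      (fun k => isPreconnected_Icc.image _ (hf.iterate _).continuousOn) fun k => ?_
    refine ⟨f^[k * n + (r + 1)] (f^[n] t₀), mem_image_of_mem _ ht₀', t₀, ht₀, ?_⟩
    rw [← iterate_add_apply, Order.succ_eq_add_one, add_mul, one_mul]
    congr 1
    omega
  have hmem : ∀ l, 1 ≤ l → ∀ t ∈ Icc a b, f^[l] t ∈ ⋃ r : Fin n, G r := by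
    intro l hl t ht
    refine mem_iUnion.2 ⟨⟨(l - 1) % n, Nat.mod_lt _ hn⟩, mem_iUnion.2 ⟨(l - 1) / n, t, ht, ?_⟩⟩
    congr 1
    have := Nat.div_add_mod' (l - 1) n
    simp only
    omega
  have hGx : ∀ r, ∀ z ∈ G r, ∀ i, f^[i] z ≠ x := by
    intro r z hz i
    obtain ⟨k, t, ht, rfl⟩ := mem_iUnion.1 hz
    rw [← iterate_add_apply]
    exact hcon' _ (by omega) t ht
  have hz : ∀ i : ℕ, ∃ r : Fin n, ∃ z ∈ closure (G r), f^[i] z = x := by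
    intro i
    have hcomp : IsCompact (f^[i] '' closure (⋃ r : Fin n, G r)) :=
      isClosed_closure.isCompact.image (hf.iterate i)
    have hxcl : x ∈ f^[i] '' closure (⋃ r : Fin n, G r) := by
      rw [← hcomp.isClosed.closure_eq, mem_closure_iff_nhds]
      intro V hV
      obtain ⟨V', hV', hlong⟩ := eventually_iterate_notMem hf hx i
      obtain ⟨m, hm, _, ⟨t, ht, rfl⟩, ht'⟩ := hnw _ (inter_mem (inter_mem hV hV') habn)
      have hmi : i < m := by
        by_contra! hle
        exact hlong m hm hle t ht.1.2 ht'.1.2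
      refine ⟨f^[m] t, ht'.1.1, f^[m - i] t, subset_closure (hmem _ (by omega) t ht.2), ?_⟩
      rw [← iterate_add_apply]
      congr 1
      omega
    obtain ⟨z, hz, e⟩ := hxcl
    rw [closure_iUnion_of_finite] at hz
    obtain ⟨r, hr⟩ := mem_iUnion.1 hz
    exact ⟨r, z, hr, e⟩
  choose r z hzcl hzx using hz
  have hinj : Injective z := by
    have hlt : ∀ i j, i < j → z i ≠ z j := by
      intro i j hij e
      refine hx ⟨j - i, by omega, ?_⟩
      have h1 := hzx j
      rw [← e, show j = (j - i) + i by omega, iterate_add_apply, hzx i] at h1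
      exact h1
    intro i j e
    by_contra hne
    rcases Nat.lt_or_gt_of_ne hne with h | h
    · exact hlt i j h e
    · exact hlt j i h e.symm
  have hfin : (⋃ r : Fin n, closure (G r) \ G r).Finite :=
    finite_iUnion fun r => finite_closure_diff (hGconn r)
  refine (infinite_range_of_injective hinj) (hfin.subset ?_)
  rintro _ ⟨i, rfl⟩
  exact mem_iUnion.2 ⟨r i, hzcl i, fun h => hGx _ _ h i (hzx i)⟩

theorem lt_apply_of_ordConnected (hf : Continuous f) {J : Set α} (hJ : J.OrdConnected)
    (hJp : ∀ y ∈ J, y ∉ periodicPts f) {k : ℕ} (hk : 1 ≤ k) {y z : α} (hy : y ∈ J) (hz : z ∈ J)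
    (h : y < f^[k] y) : z < f^[k] z := by
  by_contra! hle
  obtain ⟨w, hw, e⟩ := exists_mem_uIcc_isFixedPt (hf.iterate k).continuousOn h.le hle
  exact hJp w (hJ.uIcc_subset hy hz hw) ⟨k, hk, e⟩

theorem lt_iterate_mul (hf : Continuous f) {J : Set α} (hJ : J.OrdConnected)
    (hJp : ∀ y ∈ J, y ∉ periodicPts f) {n : ℕ} (hn : 1 ≤ n) {y : α} (hy : y ∈ J)
    (hny : f^[n] y ∈ J) (h : y < f^[n] y) : ∀ k : ℕ, 1 ≤ k → y < f^[k * n] y := by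
  intro k hk
  induction k, hk using Nat.le_induction with
  | base => simpa using h
  | succ k hk ih =>
    have := lt_apply_of_ordConnected hf hJ hJp (Nat.mul_pos hk hn) hy hny ih
    rw [← iterate_add_apply] at this
    rw [Nat.succ_mul]
    exact h.trans this

/-- All returns to an order-connected set without periodic points go in the same direction. -/
theorem return_direction (hf : Continuous f) {J : Set α} (hJ : J.OrdConnected)
    (hJp : ∀ y ∈ J, y ∉ periodicPts f) :
    (∀ y ∈ J, ∀ k : ℕ, 1 ≤ k → f^[k] y ∈ J → y < f^[k] y) ∨
      (∀ y ∈ J, ∀ k : ℕ, 1 ≤ k → f^[k] y ∈ J → f^[k] y < y) := by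
  by_contra! hcon
  obtain ⟨⟨y, hy, n, hn, hny, hley⟩, z, hz, m, hm, hmz, hlez⟩ := hcon
  have hney : f^[n] y < y := lt_of_le_of_ne hley fun e => hJp y hy ⟨n, hn, e⟩
  have hnez : z < f^[m] z := lt_of_le_of_ne hlez fun e => hJp z hz ⟨m, hm, e.symm⟩
  have h1 := lt_iterate_mul hf hJ hJp hm hz hmz hnez n hn
  have h2 : f^[m * n] y < y := lt_iterate_mul (α := αᵒᵈ) (f := f) hf hJ.dual hJp hn hy hny hney m hm
  have h3 := lt_apply_of_ordConnected hf hJ hJp (Nat.mul_pos hn hm) hz hy h1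
  rw [mul_comm] at h3
  exact lt_asymm h2 h3

theorem mem_periodicPts_of_returns [CompactSpace α] (hf : Continuous f)
    (hcl : IsClosed (periodicPts f)) {x : α} {J : Set α} (hJ : J.OrdConnected) (hJx : J ∈ 𝓝 x)
    (hJp : ∀ y ∈ J, y ∉ periodicPts f)
    (hJmax : ∀ y, x ≤ y → Icc x y ⊆ (periodicPts f)ᶜ → y ∈ J)
    (hright : ∀ y ∈ J, ∀ k : ℕ, 1 ≤ k → f^[k] y ∈ J → y < f^[k] y)
    (hret : ∀ U ∈ 𝓝 x, ∃ l : ℕ, 1 ≤ l ∧ ∃ t ∈ U, f^[l] t = x) : False := by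
  have hxJ : x ∈ J := mem_of_mem_nhds hJx
  have hxP : x ∉ periodicPts f := hJp x hxJ
  have hlt {k : ℕ} (hk : 1 ≤ k) {y z : α} (hy : y ∈ J) (hz : z ∈ J) (h : y < f^[k] y) :
      z < f^[k] z := lt_apply_of_ordConnected hf hJ hJp hk hy hz h
  have hret' : ∀ U ∈ 𝓝 x, ∀ N : ℕ, ∃ m, N < m ∧ 1 ≤ m ∧ ∃ t ∈ U, t ∈ J ∧ t < x ∧ f^[m] t = x := by
    intro U hU N
    obtain ⟨V, hV, hlong⟩ := eventually_iterate_notMem hf hxP N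
    obtain ⟨m, hm, t, ht, e⟩ := hret _ (inter_mem (inter_mem hU hV) hJx)
    refine ⟨m, ?_, hm, t, ht.1.1, ht.2, ?_, e⟩
    · by_contra! hle
      exact hlong m hm hle t ht.1.2 (e ▸ mem_of_mem_nhds hV)
    · simpa [e] using hright t ht.2 m hm (e ▸ hxJ)
  -- the first periodic point to the right of `x`
  obtain ⟨b, ⟨hbP, hxb'⟩, hbmin⟩ : ∃ b, IsLeast (periodicPts f ∩ Ici x) b := by
    refine (hcl.inter isClosed_Ici).isCompact.exists_isLeast ?_
    by_contra hemp
    obtain ⟨m, -, hm, t, -, htJ, htx, e⟩ := hret' univ univ_mem 0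
    obtain ⟨M, -, hM⟩ := (isCompact_univ (X := α)).exists_isGreatest ⟨x, mem_univ _⟩
    have hMJ : M ∈ J := hJmax M (hM (mem_univ _)) fun z hz hzP => hemp ⟨z, hzP, hz.1⟩
    exact (hlt hm htJ hMJ (e.symm ▸ htx)).not_ge (hM (mem_univ _))
  have hxb : x < b := lt_of_le_of_ne hxb' fun e => hxP (e ▸ hbP)
  have hIco : ∀ y, x ≤ y → y < b → y ∈ J := fun y hxy hyb =>
    hJmax y hxy fun z hz hzP => (hz.2.trans_lt hyb).not_ge (hbmin ⟨hzP, hz.1⟩)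
  -- the points whose forward orbit avoids `x`
  let B : Set α := {w | ∀ k, 1 ≤ k → f^[k] w ≠ x}
  have hBb : Icc x b ⊆ B := by
    intro w hw k hk e
    rcases hw.2.lt_or_eq with hwb | rfl
    · have := hright w (hIco w hw.1 hwb) k hk (e ▸ hxJ)
      exact (e ▸ this).not_ge hw.1
    · exact hxP (mem_periodicPts_of_iterate hbP e)
  have hBim : ∀ k, ∀ w ∈ B, f^[k] w ∈ B := by
    intro k w hw l hl e
    rw [← iterate_add_apply] at e
    exact hw _ (by omega) e
  have hBint : ∀ i, ∀ s ⊆ B, f^[i] x ∉ interior s := by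
    intro i s hs hi
    obtain ⟨m, hm, -, t, ht, -, -, e⟩ := hret' (f^[i] ⁻¹' interior s)
      ((hf.iterate i).continuousAt (isOpen_interior.mem_nhds hi)) i
    refine hs (interior_subset ht) (m - i) (by omega) ?_
    rwa [← iterate_add_apply, Nat.sub_add_cancel hm.le]
  obtain ⟨p, hp, hpb⟩ := hbP
  have hbx : ∀ n, 1 ≤ n → f^[n] b = b → b ≤ f^[n] x := by
    intro n hn0 hn
    by_contra! hlt'
    rcases lt_or_ge x (f^[n] x) with h | h
    · exact hBint n (Ioo x b) (Ioo_subset_Icc_self.trans hBb) (by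
        rw [isOpen_Ioo.interior_eq]; exact ⟨h, hlt'⟩)
    · obtain ⟨w, hw, e⟩ := image_Icc_superset (hf.iterate n) (left_mem_Icc.2 hxb.le)
        (right_mem_Icc.2 hxb.le) (show x ∈ Icc (f^[n] x) (f^[n] b) from ⟨h, hn.symm ▸ hxb.le⟩)
      exact hBb hw n hn0 e
  have hBc : ∀ n, 1 ≤ n → f^[n] b = b → Icc x (f^[n] x) ⊆ B := by
    intro n hn0 hn z hz
    rcases le_total z b with hzb | hzb
    · exact hBb ⟨hz.1, hzb⟩
    · obtain ⟨w, hw, e⟩ := image_Icc_superset (hf.iterate n) (right_mem_Icc.2 hxb.le)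
        (left_mem_Icc.2 hxb.le) (show z ∈ Icc (f^[n] b) (f^[n] x) from ⟨hn.symm ▸ hzb, hz.2⟩)
      exact e ▸ hBim n w (hBb hw)
  have hBIoo : ∀ i n, 1 ≤ n → f^[n] b = b → x < f^[i] x → f^[n] x ≤ f^[i] x := by
    intro i n hn0 hn hi
    by_contra! hlt'
    refine hBint i (Ioo x (f^[n] x)) (Ioo_subset_Icc_self.trans (hBc n hn0 hn)) ?_
    rw [isOpen_Ioo.interior_eq]
    exact ⟨hi, hlt'⟩
  -- `x` is eventually periodic
  obtain ⟨c, hc⟩ : ∃ c, c = f^[p] x := ⟨_, rfl⟩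
  have hbc : b ≤ c := hc ▸ hbx p hp hpb
  have hxc : x < c := hxb.trans_le hbc
  have hcp : f^[p] c = c := by
    have h2p : f^[p + p] b = b := by rw [iterate_add_apply, hpb, hpb]
    have h2 := hxb.trans_le (hbx _ (by omega) h2p)
    have h3 := hBIoo p (p + p) (by omega) h2p (hc ▸ hxc)
    have h4 := hBIoo (p + p) p hp hpb h2
    rw [hc, ← iterate_add_apply]
    exact le_antisymm h3 h4
  have hBxc : Icc x c ⊆ B := hc ▸ hBc p hp hpb
  have hmod : ∀ n, f^[n] c = f^[n % p] c := fun n =>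
    (IsPeriodicPt.iterate_mod_apply hcp n).symm
  have hxmod : ∀ n, p ≤ n → f^[n] x = f^[n % p] c := by
    intro n hn
    rw [Nat.mod_eq_sub_mod hn, ← hmod, hc, ← iterate_add_apply, Nat.sub_add_cancel hn]
  obtain ⟨r, hr⟩ : ∃ r, ∀ U ∈ 𝓝 x, ∀ N : ℕ, ∃ m, N < m ∧ m % p = r ∧ 1 ≤ m ∧
      ∃ t ∈ U, t ∈ J ∧ t < x ∧ f^[m] t = x := by
    by_contra! hcon
    choose U hU N hUN using hcon
    obtain ⟨m, hm, hm1, t, ht, h⟩ := hret' (⋂ i ∈ Finset.range p, U i)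
      ((biInter_finset_mem _).2 fun i _ => hU i) (∑ i ∈ Finset.range p, N i)
    have hmem : m % p ∈ Finset.range p := Finset.mem_range.2 (Nat.mod_lt _ hp)
    exact hUN (m % p) m
      ((Finset.single_le_sum (fun i _ => Nat.zero_le (N i)) hmem).trans_lt hm) rfl hm1 t
      (mem_iInter₂.1 ht _ hmem) h.1 h.2.1 h.2.2
  have hcr : c ≤ f^[r] c := by
    obtain ⟨m, hm, hmr, hm1, t, -, htJ, htx, e⟩ := hr univ univ_mem p
    have h1 : x < f^[m] x := hlt hm1 htJ hxJ (e.symm ▸ htx)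
    have h2 := hBIoo m p hp hpb h1
    rwa [hxmod m hm.le, hmr, ← hc] at h2
  have hcx : f^[p] c ≠ x := hcp.symm ▸ hxc.ne'
  -- points near `x` on the left are mapped by `f^[p]` to the right of `c`
  have hcy : ∀ t m, p < m → x < f^[p] t → f^[m] t = x → c < f^[p] t := by
    intro t m hm hxt e
    by_contra! hle
    refine hBxc ⟨hxt.le, hle⟩ (m - p) (by omega) ?_
    rwa [← iterate_add_apply, Nat.sub_add_cancel hm.le]
  have hpc : ∀ V ∈ 𝓝 c, f^[p] ⁻¹' V ∈ 𝓝 x := fun V hV =>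
    (hf.iterate p).continuousAt (hc ▸ hV)
  obtain ⟨s, m₀, hm₀, hsm₀, hxs, hcy₀, hy₀x, hy₀r⟩ : ∃ s m₀, m₀ % p = r ∧ f^[m₀] s = x ∧
      x < f^[p] s ∧ c < f^[p] s ∧ (∀ z ∈ Icc c (f^[p] s), f^[p] z ≠ x) ∧
      (f^[r] c = c ∨ f^[p] s ≤ f^[r] c) := by
    obtain ⟨a₁, a₂, hca, haN, haO⟩ := exists_Icc_mem_subset_of_mem_nhds
      ((hf.iterate p).continuousAt (isOpen_ne.mem_nhds hcx))
    have hN : {v | f^[r] c = c ∨ v ≤ f^[r] c} ∈ 𝓝 c := by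
      rcases hcr.eq_or_lt with h | h
      · exact Filter.univ_mem' fun v => Or.inl h.symm
      · exact mem_of_superset (Iic_mem_nhds h) fun v hv => Or.inr hv
    obtain ⟨m, hm, hmr, -, t, ⟨⟨hta, htx⟩, htr⟩, -, -, e⟩ :=
      hr _ (hpc _ (inter_mem (inter_mem haN (Ioi_mem_nhds hxc)) hN)) p
    exact ⟨t, m, hmr, e, htx, hcy t m hm htx e,
      fun z hz => haO ⟨hca.1.trans hz.1, hz.2.trans hta.2⟩, htr⟩
  obtain ⟨y, hy⟩ : ∃ y, y = f^[p] s := ⟨_, rfl⟩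
  rw [← hy] at hcy₀ hy₀x hy₀r
  obtain ⟨u₁, u₂, hxu, huN, huO⟩ := exists_Icc_mem_subset_of_mem_nhds
    (inter_mem (hpc _ (Ioo_mem_nhds hxc hcy₀)) (hpc _ (isOpen_ne.mem_nhds hxc.ne')))
  obtain ⟨m, hm, hmr, -, t, htu, htJ, htx, e⟩ := hr _ huN (m₀ + 2 * p)
  obtain ⟨w, hw⟩ : ∃ w, w = f^[p] t := ⟨_, rfl⟩
  have hcw : c < w := hw ▸ hcy t m (by omega) (huO htu).1.1 e
  have hwy : w < y := hw ▸ (huO htu).1.2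
  obtain ⟨z, hz⟩ : ∃ z, z = f^[m - p] t := ⟨_, rfl⟩
  have hzx : f^[p] z = x := by
    rw [hz, ← iterate_add_apply, show p + (m - p) = m by omega, e]
  have hzB : z ∉ B := fun h => h p hp hzx
  have hmpr : (m - p) % p = r := by rw [← Nat.mod_eq_sub_mod (by omega), hmr]
  have htz : t < z := by
    have h1 : f^[m - p] x = f^[r] c := by rw [hxmod _ (by omega), hmpr]
    rw [hz]
    exact hlt (by omega) hxJ htJ (h1 ▸ hxc.trans_le hcr)
  have hyz : y < z := by
    by_contra! hle
    rcases lt_or_ge z x with h | h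
    · exact (huO ⟨htu.1.trans htz.le, h.le.trans hxu.2⟩).2 hzx
    · rcases le_total z c with h' | h'
      · exact hzB (hBxc ⟨h, h'⟩)
      · exact hy₀x z ⟨h', hle⟩ hzx
  have hwz : f^[m - 2 * p] w = z := by
    rw [hw, hz, ← iterate_add_apply]
    congr 1
    omega
  have hyc : f^[m - 2 * p] y = c := by
    rw [hy, ← iterate_add_apply, show m - 2 * p + p = (m - p - m₀) + m₀ by omega,
      iterate_add_apply, hsm₀, hxmod _ (by omega)]
    have : (m - p - m₀) % p = 0 :=
      Nat.sub_mod_eq_zero_of_mod_eq (hmpr.trans hm₀.symm)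
    rw [this, iterate_zero_apply]
  have hL : Icc c y ⊆ f^[m - 2 * p] '' Icc w y := by
    have := image_Icc_superset (hf.iterate (m - 2 * p)) (right_mem_Icc.2 hwy.le)
      (left_mem_Icc.2 hwy.le)
    rw [hyc, hwz] at this
    exact (Icc_subset_Icc_right hyz.le).trans this
  have hK : ∃ n, 1 ≤ n ∧ Icc c y ⊆ f^[n] '' Icc c w := by
    rcases hy₀r with hrc | hyr
    · refine ⟨m - 2 * p, by omega, ?_⟩
      have := image_Icc_superset (hf.iterate (m - 2 * p)) (left_mem_Icc.2 hcw.le)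
        (right_mem_Icc.2 hcw.le)
      have h2 : (m - 2 * p) % p = r := by
        rw [← hmpr, show m - 2 * p = m - p - p by omega, ← Nat.mod_eq_sub_mod (by omega)]
      rw [hwz, hmod, h2, hrc] at this
      exact (Icc_subset_Icc_right hyz.le).trans this
    · refine ⟨m, by omega, ?_⟩
      have := image_Icc_superset (hf.iterate m) (right_mem_Icc.2 hcw.le) (left_mem_Icc.2 hcw.le)
      have h2 : f^[m] w = c := by
        rw [hw, ← iterate_add_apply, Nat.add_comm, iterate_add_apply, e, ← hc]
      rw [h2, hmod, hmr] at this
      exact (Icc_subset_Icc_right hyr).trans this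
  obtain ⟨n, hn, hK⟩ := hK
  have hwP := mem_periodicPts_of_horseshoe hf hcl hcw.le hwy.le hn (by omega) hK hL
  have hzP : z ∈ periodicPts f := mem_periodicPts_of_iterate hwP hwz
  exact hxP (mem_periodicPts_of_iterate hzP hzx)

/-- If the periodic points of a continuous self-map of a compact interval form a closed set,
every non-wandering point is periodic. -/
theorem mem_periodicPts_of_nonwandering [CompactSpace α] (hf : Continuous f)
    (hcl : IsClosed (periodicPts f)) {x : α}
    (hnw : ∀ U ∈ 𝓝 x, ∃ n : ℕ, 1 ≤ n ∧ (f^[n] '' U ∩ U).Nonempty) : x ∈ periodicPts f := by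
  by_contra hx
  have hret : ∀ U ∈ 𝓝 x, ∃ l : ℕ, 1 ≤ l ∧ ∃ t ∈ U, f^[l] t = x :=
    fun U hU => exists_iterate_eq_of_nonwandering hf hx hnw hU
  have hJ : (ordConnectedComponent (periodicPts f)ᶜ x).OrdConnected := inferInstance
  have hJx : ordConnectedComponent (periodicPts f)ᶜ x ∈ 𝓝 x :=
    ordConnectedComponent_mem_nhds.2 (hcl.isOpen_compl.mem_nhds hx)
  have hJp : ∀ y ∈ ordConnectedComponent (periodicPts f)ᶜ x, y ∉ periodicPts f :=
    fun y hy => ordConnectedComponent_subset hy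
  rcases return_direction hf hJ hJp with h | h
  · exact mem_periodicPts_of_returns hf hcl hJ hJx hJp
      (fun y hxy hs => by rwa [mem_ordConnectedComponent, uIcc_of_le hxy]) h hret
  · have : CompactSpace αᵒᵈ := ‹CompactSpace α›
    refine mem_periodicPts_of_returns (α := αᵒᵈ) (f := f) hf hcl hJ.dual hJx hJp
      (fun y hxy hs => ?_) h hret
    have hxy' : OrderDual.ofDual y ≤ x := hxy
    change uIcc x (OrderDual.ofDual y) ⊆ _
    rw [uIcc_of_ge hxy']
    exact fun z hz => hs ⟨hz.2, hz.1⟩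

end IntervalMap

/-- Xiong–Nitecki: for a continuous self-map of a compact interval,
Per(f) is closed iff Per(f) = Ω(f). -/
theorem interval_map_per_closed_iff_eq_nonWandering
    (f : Set.Icc (0 : ℝ) 1 → Set.Icc (0 : ℝ) 1) (hf : Continuous f) :
    IsClosed {x | ∃ n : ℕ, 1 ≤ n ∧ f^[n] x = x} ↔
      {x | ∃ n : ℕ, 1 ≤ n ∧ f^[n] x = x} =
        {x | ∀ U ∈ nhds x, ∃ n : ℕ, 1 ≤ n ∧ (f^[n] '' U ∩ U).Nonempty} := by
  constructor
  · intro hcl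
    ext x
    refine ⟨fun ⟨n, hn, hx⟩ U hU => ⟨n, hn, x, ⟨x, mem_of_mem_nhds hU, hx⟩, mem_of_mem_nhds hU⟩,
      fun hx => IntervalMap.mem_periodicPts_of_nonwandering hf hcl hx⟩
  · intro h
    rw [h, ← isOpen_compl_iff, isOpen_iff_mem_nhds]
    intro x hx
    simp only [mem_compl_iff, mem_ofPred_eq, not_forall] at hx
    obtain ⟨U, hU, hne⟩ := hx
    filter_upwards [eventually_mem_nhds_iff.2 hU] with y hy hnw
    exact hne (hnw U hy)
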